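/- In the quadratic algebra B defined by a linear involution R of E⊗E, the submodules X^r * Y^s for r, s ∈ ℕ span B: the supremum ⨆_{r,s∈ℕ} X^r * Y^s equals all of B. (This is the paper's identity A = 𝒜·𝒜' = 𝒜'·𝒜, expressing that every element of B is a sum of products of an x-monomial by a y-monomial.) -/

import Mathlib

open scoped TensorProduct
open TensorAlgebra

noncomputable section

variable (E : Type*) [AddCommGroup E] [Module ℝ E]

/-- The linear map `E ⊗ E → T(E ⊕ E)` sending `u ⊗ v` to `ι(a u) * ι(b v)` for two
linear inclusions `a b : E → E ⊕ E`; e.g. `(y⊗x)(u⊗v) = y(u)⊗x(v)`. -/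
def pairMul (a b : E →ₗ[ℝ] E × E) :
    E ⊗[ℝ] E →ₗ[ℝ] TensorAlgebra ℝ (E × E) :=
  LinearMap.mul' ℝ (TensorAlgebra ℝ (E × E)) ∘ₗ
    TensorProduct.map (ι ℝ ∘ₗ a) (ι ℝ ∘ₗ b)

/-- The relations of the paper's bigraded algebra `A`: with `x, y : E → E ⊕ E` the two
canonical inclusions, `x(u)x(v) = (x⊗x)(R(u⊗v))`, `x(u)y(v) = (y⊗x)(R(u⊗v))`,
`y(u)x(v) = (x⊗y)(R(u⊗v))` and `y(u)y(v) = −(y⊗y)(R(u⊗v))`. -/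
def BRel (R : E ⊗[ℝ] E →ₗ[ℝ] E ⊗[ℝ] E) :
    TensorAlgebra ℝ (E × E) → TensorAlgebra ℝ (E × E) → Prop :=
  fun p q => ∃ u v : E,
    (p = ι ℝ (LinearMap.inl ℝ E E u) * ι ℝ (LinearMap.inl ℝ E E v) ∧
      q = pairMul E (LinearMap.inl ℝ E E) (LinearMap.inl ℝ E E) (R (u ⊗ₜ[ℝ] v))) ∨
    (p = ι ℝ (LinearMap.inl ℝ E E u) * ι ℝ (LinearMap.inr ℝ E E v) ∧
      q = pairMul E (LinearMap.inr ℝ E E) (LinearMap.inl ℝ E E) (R (u ⊗ₜ[ℝ] v))) ∨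
    (p = ι ℝ (LinearMap.inr ℝ E E u) * ι ℝ (LinearMap.inl ℝ E E v) ∧
      q = pairMul E (LinearMap.inl ℝ E E) (LinearMap.inr ℝ E E) (R (u ⊗ₜ[ℝ] v))) ∨
    (p = ι ℝ (LinearMap.inr ℝ E E u) * ι ℝ (LinearMap.inr ℝ E E v) ∧
      q = - pairMul E (LinearMap.inr ℝ E E) (LinearMap.inr ℝ E E) (R (u ⊗ₜ[ℝ] v)))

/-- If `Y * X ≤ X * Y`, then `Y` can be moved past any power of `X`. -/
theorem Submodule.mul_pow_le_pow_mul {K A : Type*} [CommSemiring K] [Semiring A] [Algebra K A]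
    {X Y : Submodule K A} (hYX : Y * X ≤ X * Y) (r : ℕ) : Y * X ^ r ≤ X ^ r * Y := by
  induction r with
  | zero => simp
  | succ n ih =>
    calc Y * X ^ (n + 1) = Y * X ^ n * X := by rw [pow_succ, mul_assoc]
      _ ≤ X ^ n * Y * X := mul_le_mul_left ih X
      _ = X ^ n * (Y * X) := mul_assoc _ _ _
      _ ≤ X ^ n * (X * Y) := mul_le_mul_right hYX _
      _ = X ^ (n + 1) * Y := by rw [pow_succ, mul_assoc]

/-- If `X` and `Y` generate an algebra and `Y * X ≤ X * Y`, then the submodules `X ^ r * Y ^ s`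
span it. -/
theorem Submodule.iSup_pow_mul_pow_eq_top {K A : Type*} [CommSemiring K] [Semiring A]
    [Algebra K A] {X Y : Submodule K A} (hYX : Y * X ≤ X * Y)
    (hgen : Algebra.adjoin K ((X : Set A) ∪ Y) = ⊤) :
    (⨆ r : ℕ, ⨆ s : ℕ, X ^ r * Y ^ s) = ⊤ := by
  set S : Submodule K A := ⨆ r : ℕ, ⨆ s : ℕ, X ^ r * Y ^ s with hS
  have le_S (r s : ℕ) : X ^ r * Y ^ s ≤ S :=
    le_iSup_of_le r (le_iSup (fun s => X ^ r * Y ^ s) s)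
  have one_mem : (1 : A) ∈ S := le_S 0 0 (by simp [Submodule.one_le.mp le_rfl])
  have X_mul : X * S ≤ S := by
    rw [hS, Submodule.mul_iSup]
    refine iSup_le fun r => ?_
    rw [Submodule.mul_iSup]
    refine iSup_le fun s => ?_
    rw [← mul_assoc, ← pow_succ']
    exact le_S (r + 1) s
  have Y_mul : Y * S ≤ S := by
    rw [hS, Submodule.mul_iSup]
    refine iSup_le fun r => ?_
    rw [Submodule.mul_iSup]
    refine iSup_le fun s => ?_
    calc Y * (X ^ r * Y ^ s) = Y * X ^ r * Y ^ s := (mul_assoc _ _ _).symm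
      _ ≤ X ^ r * Y * Y ^ s := mul_le_mul_left (mul_pow_le_pow_mul hYX r) _
      _ = X ^ r * Y ^ (s + 1) := by rw [mul_assoc, ← pow_succ']
      _ ≤ S := le_S r (s + 1)
  have mul_mem (a : A) : ∀ b ∈ S, a * b ∈ S := by
    have ha : a ∈ Algebra.adjoin K ((X : Set A) ∪ Y) := hgen ▸ Algebra.mem_top
    induction ha using Algebra.adjoin_induction with
    | mem x hx =>
      intro b hb
      rcases hx with hx | hx
      · exact X_mul (Submodule.mul_mem_mul hx hb)
      · exact Y_mul (Submodule.mul_mem_mul hx hb)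
    | algebraMap k =>
      intro b hb
      rw [← Algebra.smul_def]
      exact S.smul_mem k hb
    | add x y _ _ hx hy =>
      intro b hb
      rw [add_mul]
      exact S.add_mem (hx b hb) (hy b hb)
    | mul x y _ _ hx hy =>
      intro b hb
      rw [mul_assoc]
      exact hx _ (hy b hb)
  exact eq_top_iff.mpr fun a _ => by simpa using mul_mem a 1 one_mem

/-- The image of `pairMul` in an algebra lies in the product of the images of the two factors. -/
theorem map_pairMul_mem {A : Type*} [Semiring A] [Algebra ℝ A]
    (f : TensorAlgebra ℝ (E × E) →ₐ[ℝ] A) (a b : E →ₗ[ℝ] E × E) (t : E ⊗[ℝ] E) :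
    f (pairMul E a b t) ∈
      LinearMap.range (f.toLinearMap ∘ₗ ι ℝ ∘ₗ a) *
        LinearMap.range (f.toLinearMap ∘ₗ ι ℝ ∘ₗ b) := by
  induction t with
  | zero => simp
  | add s t hs ht =>
    rw [map_add, map_add]
    exact Submodule.add_mem _ hs ht
  | tmul u v =>
    have h : f (pairMul E a b (u ⊗ₜ v)) = f (ι ℝ (a u)) * f (ι ℝ (b v)) := by
      simp [pairMul]
    rw [h]
    exact Submodule.mul_mem_mul ⟨u, rfl⟩ ⟨v, rfl⟩

/-- In the quadratic algebra `B` defined by a linear involution `R` of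
`E ⊗ E`, the submodules `X^r * Y^s` span `B`: `⨆_{r,s} X^r * Y^s = ⊤` (the paper's
identity `A = 𝒜·𝒜' = 𝒜'·𝒜`). -/
theorem submodule_bigraded_span_top
    [FiniteDimensional ℝ E]
    (R : E ⊗[ℝ] E →ₗ[ℝ] E ⊗[ℝ] E) (hR : R ∘ₗ R = LinearMap.id)
    (X Y : Submodule ℝ (RingQuot (BRel E R)))
    (hX : X = LinearMap.range ((RingQuot.mkAlgHom ℝ (BRel E R)).toLinearMap ∘ₗ
      ι ℝ ∘ₗ LinearMap.inl ℝ E E))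
    (hY : Y = LinearMap.range ((RingQuot.mkAlgHom ℝ (BRel E R)).toLinearMap ∘ₗ
      ι ℝ ∘ₗ LinearMap.inr ℝ E E)) :
    (⨆ r : ℕ, ⨆ s : ℕ, X ^ r * Y ^ s) = ⊤ := by
  subst hX hY
  apply Submodule.iSup_pow_mul_pow_eq_top
  · rw [Submodule.mul_le]
    rintro _ ⟨u, rfl⟩ _ ⟨v, rfl⟩
    have h := RingQuot.mkAlgHom_rel ℝ (s := BRel E R)
      ⟨u, v, Or.inr (Or.inr (Or.inl ⟨rfl, rfl⟩))⟩
    rw [map_mul] at h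
    exact h ▸ map_pairMul_mem E _ _ _ _
  · set π := RingQuot.mkAlgHom ℝ (BRel E R)
    have hπ : (⊤ : Subalgebra ℝ (TensorAlgebra ℝ (E × E))).map π = ⊤ := by
      rw [Algebra.map_top]
      exact (AlgHom.range_eq_top π).mpr (RingQuot.mkAlgHom_surjective ℝ _)
    rw [eq_top_iff, ← hπ, ← TensorAlgebra.adjoin_range_ι, AlgHom.map_adjoin]
    refine Algebra.adjoin_le ?_
    rintro _ ⟨_, ⟨⟨u, v⟩, rfl⟩, rfl⟩
    have h : π (ι ℝ (u, v)) =
        π (ι ℝ (LinearMap.inl ℝ E E u)) + π (ι ℝ (LinearMap.inr ℝ E E v)) := by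
      rw [← map_add, ← map_add]
      simp
    change π (ι ℝ (u, v)) ∈ _
    rw [h]
    exact add_mem (Algebra.subset_adjoin (Or.inl ⟨u, rfl⟩))
      (Algebra.subset_adjoin (Or.inr ⟨v, rfl⟩))
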